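/- Let (V, 𝒜, β) be a σ-finite measure space, H a real Hilbert space, and Ψ : H → ℝ twice Fréchet differentiable with ‖Ψ''(z)‖ ≤ h₂(‖z‖) for all z ∈ H, where h₂ is quasi-sublinear with constant C. Let x ∈ H and let u : V → H be strongly measurable with ∫_V ‖u(v)‖² β(dv) < ∞ and ∫_V h₂(‖u(v)‖)·‖u(v)‖² β(dv) < ∞. Then ∫_V |Ψ(x+u(v)) − Ψ(x) − Ψ'(x)(u(v))| β(dv) ≤ C·h₂(‖x‖)·∫_V ‖u(v)‖² β(dv) + C²·h₂(1)·∫_V h₂(‖u(v)‖)·‖u(v)‖² β(dv) < ∞. -/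

import Mathlib

open MeasureTheory

/-- A continuous, non-decreasing function `h : [0,∞) → [0,∞)` is quasi-sublinear
with constant `C > 0` if `h(x+y) ≤ C(h(x)+h(y))` and `h(xy) ≤ C·h(x)·h(y)`. -/
structure IsQuasiSublinear (h : ℝ → ℝ) (C : ℝ) : Prop where
  pos : 0 < C
  nonneg : ∀ x : ℝ, 0 ≤ x → 0 ≤ h x
  mono : MonotoneOn h (Set.Ici 0)
  cont : ContinuousOn h (Set.Ici 0)
  add_le : ∀ x y : ℝ, 0 ≤ x → 0 ≤ y → h (x + y) ≤ C * (h x + h y)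
  mul_le : ∀ x y : ℝ, 0 ≤ x → 0 ≤ y → h (x * y) ≤ C * h x * h y

/-- First-order Taylor remainder bound from a bound on the second derivative on a ball. -/
theorem abs_taylor_remainder_le
    {E : Type*} [NormedAddCommGroup E] [NormedSpace ℝ E]
    {f : E → ℝ} {f' : E → E →L[ℝ] ℝ} {f'' : E → E →L[ℝ] E →L[ℝ] ℝ}
    (hf : ∀ z, HasFDerivAt f (f' z) z) (hf' : ∀ z, HasFDerivAt f' (f'' z) z)
    {x w : E} {M : ℝ} (hM : ∀ z ∈ Metric.closedBall x ‖w‖, ‖f'' z‖ ≤ M) :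
    |f (x + w) - f x - f' x w| ≤ M * ‖w‖ ^ 2 := by
  have hM0 : 0 ≤ M :=
    (norm_nonneg (f'' x)).trans (hM x (Metric.mem_closedBall_self (norm_nonneg w)))
  have hx : x ∈ Metric.closedBall x ‖w‖ := Metric.mem_closedBall_self (norm_nonneg w)
  have hxw : x + w ∈ Metric.closedBall x ‖w‖ := by simp
  have hconv := convex_closedBall x ‖w‖
  have hf'_sub : ∀ z ∈ Metric.closedBall x ‖w‖, ‖f' z - f' x‖ ≤ M * ‖w‖ := fun z hz =>
    (hconv.norm_image_sub_le_of_norm_hasFDerivWithin_le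
      (fun y _ => (hf' y).hasFDerivWithinAt) hM hx hz).trans
      (mul_le_mul_of_nonneg_left (mem_closedBall_iff_norm.1 hz) hM0)
  have h := hconv.norm_image_sub_le_of_norm_hasFDerivWithin_le'
    (fun y _ => (hf y).hasFDerivWithinAt) hf'_sub hx hxw
  rw [add_sub_cancel_left, Real.norm_eq_abs] at h
  exact h.trans_eq (by ring)

theorem IsQuasiSublinear.add_le_mul_one {h : ℝ → ℝ} {C : ℝ} (hh : IsQuasiSublinear h C)
    {a b : ℝ} (ha : 0 ≤ a) (hb : 0 ≤ b) :
    h (a + b) ≤ C * h a + C ^ 2 * h 1 * h b := by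
  have h1 := hh.mul_le 1 b zero_le_one hb
  rw [one_mul] at h1
  have h2 := mul_le_mul_of_nonneg_left h1 hh.pos.le
  linarith [hh.add_le a b ha hb]

/-- Integral estimate for the compensator (jump) term of the generator under a
quasi-sublinear bound on the second Fréchet derivative. -/
theorem compensator_term_integrable_and_bounded
    {V : Type*} [MeasurableSpace V] (β : Measure V) [SigmaFinite β]
    {H : Type*} [NormedAddCommGroup H] [InnerProductSpace ℝ H] [CompleteSpace H]
    (Ψ : H → ℝ) (Ψ' : H → H →L[ℝ] ℝ) (Ψ'' : H → H →L[ℝ] H →L[ℝ] ℝ)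
    (hΨ' : ∀ z : H, HasFDerivAt Ψ (Ψ' z) z)
    (hΨ'' : ∀ z : H, HasFDerivAt Ψ' (Ψ'' z) z)
    (h₂ : ℝ → ℝ) (C : ℝ) (hqs : IsQuasiSublinear h₂ C)
    (hbound : ∀ z : H, ‖Ψ'' z‖ ≤ h₂ ‖z‖)
    (x : H) (u : V → H) (hu : StronglyMeasurable u)
    (hu2 : Integrable (fun v => ‖u v‖ ^ 2) β)
    (huh : Integrable (fun v => h₂ ‖u v‖ * ‖u v‖ ^ 2) β) :
    Integrable (fun v => |Ψ (x + u v) - Ψ x - Ψ' x (u v)|) β ∧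
    ∫ v, |Ψ (x + u v) - Ψ x - Ψ' x (u v)| ∂β
      ≤ C * h₂ ‖x‖ * ∫ v, ‖u v‖ ^ 2 ∂β
        + C ^ 2 * h₂ 1 * ∫ v, h₂ ‖u v‖ * ‖u v‖ ^ 2 ∂β := by
  have hle : ∀ v, |Ψ (x + u v) - Ψ x - Ψ' x (u v)|
      ≤ C * h₂ ‖x‖ * ‖u v‖ ^ 2 + C ^ 2 * h₂ 1 * (h₂ ‖u v‖ * ‖u v‖ ^ 2) := fun v => by
    have hball : ∀ z ∈ Metric.closedBall x ‖u v‖,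
        ‖Ψ'' z‖ ≤ C * h₂ ‖x‖ + C ^ 2 * h₂ 1 * h₂ ‖u v‖ := fun z hz =>
      ((hbound z).trans (hqs.mono (norm_nonneg z)
        (add_nonneg (norm_nonneg x) (norm_nonneg (u v)))
        (norm_le_of_mem_closedBall hz))).trans
        (hqs.add_le_mul_one (norm_nonneg x) (norm_nonneg (u v)))
    exact (abs_taylor_remainder_le hΨ' hΨ'' hball).trans_eq (by ring)
  have hint₁ := hu2.const_mul (C * h₂ ‖x‖)
  have hint₂ := huh.const_mul (C ^ 2 * h₂ 1)
  have hcont : Continuous fun w => |Ψ (x + w) - Ψ x - Ψ' x w| := by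
    have hΨ : Continuous Ψ := continuous_iff_continuousAt.2 fun z => (hΨ' z).continuousAt
    fun_prop
  have hint : Integrable (fun v => |Ψ (x + u v) - Ψ x - Ψ' x (u v)|) β :=
    (hint₁.add hint₂).mono' (hcont.comp_stronglyMeasurable hu).aestronglyMeasurable
      (.of_forall fun v => by simpa only [Real.norm_eq_abs, abs_abs, Pi.add_apply] using hle v)
  refine ⟨hint, (integral_mono hint (hint₁.add hint₂) hle).trans_eq ?_⟩
  simp only [Pi.add_apply]
  rw [integral_add hint₁ hint₂, integral_const_mul, integral_const_mul]
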